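/- Let X be a one-sided subshift of finite type with metric d_θ, θ ∈ (0,1), let δ > 0, m ∈ ℕ, and let g : X → (0,∞) be constant on every cylinder of length m with values in δℤ, with δ ≤ g ≤ Nδ for an integer N ≥ 1. Let (X_g, σ_g) be the discretised subshift of finite type over the finite alphabet {(W,k) : W a cylinder of X of length m, 0 ≤ k < g(W)/δ}, and let π̃ : X_g → X be the itinerary (projection) map sending a sequence in X_g to the element of X obtained by reading off, at the successive return times to fiber-level 0, the first symbols of the corresponding base cylinders. If x̄, ȳ ∈ X_g satisfy d_θ(x̄, ȳ) ≤ θ^{kN} for some k ∈ ℕ, then d_θ(π̃(x̄), π̃(ȳ)) ≤ θ^{k}. Consequently, π̃ is Hölder continuous from (X_g, d_θ) to (X, d_θ), and for every d_θ-Hölder continuous φ : X → ℝ the composition φ̃ = φ ∘ π̃ is Hölder continuous on (X_g, d_θ). -/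

import Mathlib

open Filter Set MeasureTheory

noncomputable section

/-- The one-sided full shift map on sequences over the alphabet `Fin a`. -/
def shiftMap (a : ℕ) : (ℕ → Fin a) → (ℕ → Fin a) := fun x n => x (n + 1)

/-- The one-sided subshift of finite type determined by the 0-1 transition matrix `A`. -/
def SFT {a : ℕ} (A : Matrix (Fin a) (Fin a) ℕ) : Set (ℕ → Fin a) :=
  {x | ∀ n, A (x n) (x (n + 1)) = 1}

/-- The cylinder of length `n` around `x`. -/
def cyl {a : ℕ} (x : ℕ → Fin a) (n : ℕ) : Set (ℕ → Fin a) := {y | ∀ i < n, y i = x i}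


open Classical in
/-- The metric `d_θ` on a sequence space: `d_θ(u,v) = θ^{min{n : u n ≠ v n}}`, `d_θ(u,u)=0`. -/
def dSeq {B : Type*} (θ : ℝ) (u v : ℕ → B) : ℝ :=
  if u = v then 0 else θ ^ sInf {n | u n ≠ v n}

/-- A word `W` of length `m` is allowed if it occurs as an initial segment of a point of
`X = SFT A`. -/
def wordOK {a m : ℕ} (A : Matrix (Fin a) (Fin a) ℕ) (W : Fin m → Fin a) : Prop :=
  ∃ x ∈ SFT A, ∀ i : Fin m, x (i : ℕ) = W i

/-- The canonical extension of a word of positive length `m` to a sequence. -/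
def extendW {a m : ℕ} (hm : 0 < m) (W : Fin m → Fin a) : ℕ → Fin a :=
  fun n => if h : n < m then W ⟨n, h⟩ else W ⟨0, hm⟩

/-- Allowed transitions of the discretised subshift `X_g` over the alphabet
`{(W,k) : W ∈ ξ_m, 0 ≤ k < g(W)/δ}`: either move one level up the fiber over the same
cylinder, or, from the top fiber level, jump to level `0` over a compatible shifted
cylinder. -/
def transOK {a m : ℕ} (A : Matrix (Fin a) (Fin a) ℕ) (g : (ℕ → Fin a) → ℝ) (δ : ℝ)
    (hm : 0 < m) (u v : (Fin m → Fin a) × ℕ) : Prop :=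
  (v.1 = u.1 ∧ v.2 = u.2 + 1 ∧ ((u.2 + 1 : ℕ) : ℝ) < g (extendW hm u.1) / δ) ∨
  (((u.2 + 1 : ℕ) : ℝ) = g (extendW hm u.1) / δ ∧ v.2 = 0 ∧
    (∀ i : ℕ, ∀ (h1 : i + 1 < m) (h2 : i < m), v.1 ⟨i, h2⟩ = u.1 ⟨i + 1, h1⟩) ∧
    (∃ x ∈ SFT A, (∀ i : Fin m, x (i : ℕ) = u.1 i) ∧ x m = v.1 ⟨m - 1, Nat.sub_lt hm Nat.one_pos⟩))

/-- The discretised subshift of finite type `X_g` associated to the discretisation of the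
special semi-flow with roof function `g`, time step `δ` and cylinders of length `m`. -/
def Xg {a m : ℕ} (A : Matrix (Fin a) (Fin a) ℕ) (g : (ℕ → Fin a) → ℝ) (δ : ℝ)
    (hm : 0 < m) : Set (ℕ → ((Fin m → Fin a) × ℕ)) :=
  {y | ∀ n, wordOK A (y n).1 ∧ (((y n).2 : ℕ) : ℝ) < g (extendW hm (y n).1) / δ ∧
        transOK A g δ hm (y n) (y (n + 1))}

/-- The successive return times to fiber-level `0` of a sequence in `X_g`:
`i_0 = 0` and `i_{n+1} = min{k > i_n : fiber level at k is 0}`. -/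
def retIdx {a m : ℕ} (y : ℕ → ((Fin m → Fin a) × ℕ)) : ℕ → ℕ
  | 0 => 0
  | n + 1 => sInf {k | retIdx y n < k ∧ (y k).2 = 0}

/-- The itinerary (projection) map `π̃ : X_g → X`, reading off the first symbols of the
base cylinders at the successive returns to fiber-level `0`. -/
def itin {a m : ℕ} (hm : 0 < m) (y : ℕ → ((Fin m → Fin a) × ℕ)) : ℕ → Fin a :=
  fun n => (y (retIdx y n)).1 ⟨0, hm⟩

section Metric

variable {B : Type*} {θ : ℝ}

theorem dSeq_le_pow_iff (hθ : θ ∈ Set.Ioo (0 : ℝ) 1) (u v : ℕ → B) (k : ℕ) :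
    dSeq θ u v ≤ θ ^ k ↔ ∀ i < k, u i = v i := by
  unfold dSeq
  split_ifs with h
  · simp [h, pow_nonneg hθ.1.le]
  · rw [pow_le_pow_iff_right_of_lt_one₀ hθ.1 hθ.2]
    obtain ⟨n, hn⟩ := Function.ne_iff.mp h
    constructor
    · intro hk i hi
      by_contra hne
      exact absurd (Nat.sInf_le (s := {n | u n ≠ v n}) hne) (by omega)
    · intro hk
      by_contra! hlt
      exact Nat.sInf_mem (s := {n | u n ≠ v n}) ⟨n, hn⟩ (hk _ hlt)

theorem dSeq_nonneg (hθ : 0 ≤ θ) (u v : ℕ → B) : 0 ≤ dSeq θ u v := by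
  unfold dSeq
  split_ifs
  · exact le_rfl
  · positivity

theorem eq_or_exists_dSeq_eq_pow (u v : ℕ → B) : u = v ∨ ∃ n : ℕ, dSeq θ u v = θ ^ n := by
  by_cases h : u = v
  · exact .inl h
  · exact .inr ⟨_, if_neg h⟩

/-- A map under which agreement of the first `k * N` symbols yields agreement of the images to
order `k` is `1 / N`-Hölder for `dSeq`. -/
theorem dSeq_le_inv_mul_rpow {C : Type*} (hθ : θ ∈ Set.Ioo (0 : ℝ) 1) {N : ℕ} (hN : 1 ≤ N)
    {u v : ℕ → B} {u' v' : ℕ → C} (heq : u = v → u' = v')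
    (h : ∀ k : ℕ, dSeq θ u v ≤ θ ^ (k * N) → dSeq θ u' v' ≤ θ ^ k) :
    dSeq θ u' v' ≤ θ⁻¹ * dSeq θ u v ^ (1 / N : ℝ) := by
  have hN0 : (0 : ℝ) < N := by exact_mod_cast hN
  rcases eq_or_exists_dSeq_eq_pow (θ := θ) u v with huv | ⟨n, hn⟩
  · have hzero : dSeq θ u' v' = 0 := if_pos (heq huv)
    rw [hzero]
    exact mul_nonneg (inv_nonneg.mpr hθ.1.le) (Real.rpow_nonneg (dSeq_nonneg hθ.1.le _ _) _)
  · refine (h (n / N) ?_).trans ?_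
    · rw [hn]
      exact pow_le_pow_of_le_one hθ.1.le hθ.2.le (Nat.div_mul_le_self n N)
    · rw [hn, ← Real.rpow_natCast, ← Real.rpow_natCast, ← Real.rpow_mul hθ.1.le,
        ← Real.rpow_neg_one, ← Real.rpow_add hθ.1]
      apply Real.rpow_le_rpow_of_exponent_ge hθ.1 hθ.2.le
      have hlt : (n : ℝ) < N * ((n / N : ℕ) + 1) := by
        exact_mod_cast Nat.lt_mul_div_succ n hN
      have hle : (n : ℝ) * (1 / N) ≤ (n / N : ℕ) + 1 := by
        rw [mul_one_div, div_le_iff₀ hN0]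
        linarith
      linarith

end Metric

section Itinerary

variable {a m : ℕ} {A : Matrix (Fin a) (Fin a) ℕ} {g : (ℕ → Fin a) → ℝ} {δ : ℝ} {hm : 0 < m}
  {N : ℕ} {y : ℕ → ((Fin m → Fin a) × ℕ)}

theorem level_lt_of_mem_Xg (hδ : 0 < δ) (hg : ∀ x, g x ≤ N * δ) (hy : y ∈ Xg A g δ hm) (n : ℕ) :
    (y n).2 < N := by
  have h := (hy n).2.1.trans_le ((div_le_iff₀ hδ).mpr (hg _))
  exact_mod_cast h

theorem step_of_mem_Xg (hy : y ∈ Xg A g δ hm) {n : ℕ} (h0 : (y (n + 1)).2 ≠ 0) :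
    (y (n + 1)).1 = (y n).1 ∧ (y (n + 1)).2 = (y n).2 + 1 := by
  rcases (hy n).2.2 with h | h
  · exact ⟨h.1, h.2.1⟩
  · exact absurd h.2.1 h0

theorem climb_of_mem_Xg (hy : y ∈ Xg A g δ hm) (p j : ℕ)
    (h0 : ∀ k, p < k → k ≤ p + j → (y k).2 ≠ 0) :
    (y (p + j)).1 = (y p).1 ∧ (y (p + j)).2 = (y p).2 + j := by
  induction j with
  | zero => simp
  | succ j ih =>
    have ih := ih fun k hk hkj => h0 k hk (by omega)
    have hs := step_of_mem_Xg hy (n := p + j) (h0 _ (by omega) (by omega))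
    rw [← add_assoc]
    exact ⟨hs.1.trans ih.1, by omega⟩

theorem exists_return (hδ : 0 < δ) (hg : ∀ x, g x ≤ N * δ) (hy : y ∈ Xg A g δ hm) (p : ℕ) :
    ∃ k, p < k ∧ k ≤ p + N ∧ (y k).2 = 0 := by
  by_contra! h
  have hc := climb_of_mem_Xg hy p N fun k hk hkN => h k hk hkN
  have := level_lt_of_mem_Xg hδ hg hy (p + N)
  omega

theorem retIdx_succ_spec (hδ : 0 < δ) (hg : ∀ x, g x ≤ N * δ) (hy : y ∈ Xg A g δ hm) (n : ℕ) :
    retIdx y n < retIdx y (n + 1) ∧ (y (retIdx y (n + 1))).2 = 0 ∧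
      retIdx y (n + 1) ≤ retIdx y n + N := by
  obtain ⟨k, hk, hkN, hk0⟩ := exists_return hδ hg hy (retIdx y n)
  have hmem := Nat.sInf_mem (s := {k | retIdx y n < k ∧ (y k).2 = 0}) ⟨k, hk, hk0⟩
  exact ⟨hmem.1, hmem.2,
    (Nat.sInf_le (s := {k | retIdx y n < k ∧ (y k).2 = 0}) ⟨hk, hk0⟩).trans hkN⟩

theorem retIdx_succ_le {n k : ℕ} (hk : retIdx y n < k) (h0 : (y k).2 = 0) :
    retIdx y (n + 1) ≤ k :=
  Nat.sInf_le (s := {k | retIdx y n < k ∧ (y k).2 = 0}) ⟨hk, h0⟩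

theorem retIdx_le_mul (hδ : 0 < δ) (hg : ∀ x, g x ≤ N * δ) (hy : y ∈ Xg A g δ hm) (n : ℕ) :
    retIdx y n ≤ n * N := by
  induction n with
  | zero => simp [retIdx]
  | succ n ih =>
    have := (retIdx_succ_spec hδ hg hy n).2.2
    rw [add_one_mul]
    omega

theorem retIdx_eq_of_agree (hδ : 0 < δ) (hg : ∀ x, g x ≤ N * δ)
    {z : ℕ → ((Fin m → Fin a) × ℕ)} (hy : y ∈ Xg A g δ hm) (hz : z ∈ Xg A g δ hm) {k : ℕ}
    (h : ∀ i < k, y i = z i) (n : ℕ) (hn : n * N < k) : retIdx y n = retIdx z n := by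
  induction n with
  | zero => rfl
  | succ n ih =>
    have ih := ih (by rw [add_one_mul] at hn; omega)
    obtain ⟨hy1, hy2, -⟩ := retIdx_succ_spec hδ hg hy n
    obtain ⟨hz1, hz2, -⟩ := retIdx_succ_spec hδ hg hz n
    have hyk := (retIdx_le_mul hδ hg hy (n + 1)).trans_lt hn
    have hzk := (retIdx_le_mul hδ hg hz (n + 1)).trans_lt hn
    apply le_antisymm
    · exact retIdx_succ_le (ih ▸ hz1) (by rw [h _ hzk, hz2])
    · exact retIdx_succ_le (ih ▸ hy1) (by rw [← h _ hyk, hy2])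

theorem itin_eq_of_agree (hδ : 0 < δ) (hg : ∀ x, g x ≤ N * δ) (hN : 1 ≤ N)
    {z : ℕ → ((Fin m → Fin a) × ℕ)} (hy : y ∈ Xg A g δ hm) (hz : z ∈ Xg A g δ hm) {k : ℕ}
    (h : ∀ i < k * N, y i = z i) (i : ℕ) (hi : i < k) : itin hm y i = itin hm z i := by
  have hiN : i * N < k * N := Nat.mul_lt_mul_of_pos_right hi hN
  unfold itin
  rw [← retIdx_eq_of_agree hδ hg hy hz h i hiN,
    h _ ((retIdx_le_mul hδ hg hy i).trans_lt hiN)]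

theorem transition_of_level_eq_zero (hy : y ∈ Xg A g δ hm) {n : ℕ} (h0 : (y (n + 1)).2 = 0) :
    A ((y n).1 ⟨0, hm⟩) ((y (n + 1)).1 ⟨0, hm⟩) = 1 := by
  rcases (hy n).2.2 with h | ⟨-, -, hshift, x, hx, hxu, hxv⟩
  · have := h.2.1
    omega
  · have hx0 : x 0 = (y n).1 ⟨0, hm⟩ := hxu ⟨0, hm⟩
    have hx1 : x 1 = (y (n + 1)).1 ⟨0, hm⟩ := by
      rcases Nat.lt_or_ge 1 m with h1 | h1
      · rw [hshift 0 h1 hm]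
        exact hxu ⟨1, h1⟩
      · obtain rfl : m = 1 := by omega
        exact hxv
    rw [← hx0, ← hx1]
    exact hx 0

theorem itin_mem_SFT (hδ : 0 < δ) (hg : ∀ x, g x ≤ N * δ) (hy : y ∈ Xg A g δ hm) :
    itin hm y ∈ SFT A := by
  intro n
  obtain ⟨hlt, h0, -⟩ := retIdx_succ_spec hδ hg hy n
  obtain ⟨j, hj⟩ : ∃ j, retIdx y (n + 1) = retIdx y n + j + 1 :=
    ⟨retIdx y (n + 1) - retIdx y n - 1, by omega⟩
  have hc := climb_of_mem_Xg hy (retIdx y n) j fun k hk hkj hk0 => by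
    have := retIdx_succ_le hk hk0
    omega
  unfold itin
  rw [hj] at h0 ⊢
  rw [← hc.1]
  exact transition_of_level_eq_zero hy h0

end Itinerary

/-- The itinerary map `π̃ : X_g → X` contracts agreements by a factor `N`
(where `δ ≤ g ≤ Nδ`): points of `X_g` agreeing on their first `kN` coordinates have
itineraries agreeing on their first `k` coordinates; hence `π̃` is Hölder continuous, and
precomposition with `π̃` preserves Hölder continuity of potentials. -/
theorem itinerary_holder
    (a : ℕ) (ha : 2 ≤ a) (A : Matrix (Fin a) (Fin a) ℕ)
    (hA01 : ∀ i j, A i j = 0 ∨ A i j = 1)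
    (hAper : ∃ d : ℕ, 0 < d ∧ ∀ i j, 0 < (A ^ d) i j)
    (θ : ℝ) (hθ : θ ∈ Set.Ioo (0 : ℝ) 1)
    (δ : ℝ) (hδ : 0 < δ) (m : ℕ) (hm : 0 < m)
    (g : (ℕ → Fin a) → ℝ)
    (hgconst : ∀ x y : ℕ → Fin a, (∀ i < m, x i = y i) → g x = g y)
    (hgval : ∀ x : ℕ → Fin a, ∃ j : ℤ, g x = j * δ)
    (N : ℕ) (hN : 1 ≤ N)
    (hgbound : ∀ x : ℕ → Fin a, δ ≤ g x ∧ g x ≤ N * δ) :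
    (∀ xb ∈ Xg A g δ hm, ∀ yb ∈ Xg A g δ hm, ∀ k : ℕ,
        (∀ i < k * N, xb i = yb i) → ∀ i < k, itin hm xb i = itin hm yb i) ∧
    (∀ xb ∈ Xg A g δ hm, ∀ yb ∈ Xg A g δ hm, ∀ k : ℕ,
        dSeq θ xb yb ≤ θ ^ (k * N) → dSeq θ (itin hm xb) (itin hm yb) ≤ θ ^ k) ∧
    (∃ C α : ℝ, 0 < C ∧ 0 < α ∧ ∀ xb ∈ Xg A g δ hm, ∀ yb ∈ Xg A g δ hm,
        dSeq θ (itin hm xb) (itin hm yb) ≤ C * dSeq θ xb yb ^ α) ∧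
    (∀ φ : (ℕ → Fin a) → ℝ,
        (∃ C α : ℝ, 0 < C ∧ 0 < α ∧ ∀ x ∈ SFT A, ∀ y ∈ SFT A,
            |φ x - φ y| ≤ C * dSeq θ x y ^ α) →
        ∃ C' α' : ℝ, 0 < C' ∧ 0 < α' ∧ ∀ xb ∈ Xg A g δ hm, ∀ yb ∈ Xg A g δ hm,
            |φ (itin hm xb) - φ (itin hm yb)| ≤ C' * dSeq θ xb yb ^ α') := by
  have hg : ∀ x, g x ≤ N * δ := fun x => (hgbound x).2
  have hagree : ∀ xb ∈ Xg A g δ hm, ∀ yb ∈ Xg A g δ hm, ∀ k : ℕ,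
      (∀ i < k * N, xb i = yb i) → ∀ i < k, itin hm xb i = itin hm yb i :=
    fun xb hx yb hy k h => itin_eq_of_agree hδ hg hN hx hy h
  have hcontr : ∀ xb ∈ Xg A g δ hm, ∀ yb ∈ Xg A g δ hm, ∀ k : ℕ,
      dSeq θ xb yb ≤ θ ^ (k * N) → dSeq θ (itin hm xb) (itin hm yb) ≤ θ ^ k := by
    intro xb hx yb hy k
    rw [dSeq_le_pow_iff hθ, dSeq_le_pow_iff hθ]
    exact hagree xb hx yb hy k
  have hholder : ∀ xb ∈ Xg A g δ hm, ∀ yb ∈ Xg A g δ hm,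
      dSeq θ (itin hm xb) (itin hm yb) ≤ θ⁻¹ * dSeq θ xb yb ^ (1 / N : ℝ) :=
    fun xb hx yb hy => dSeq_le_inv_mul_rpow hθ hN (congrArg (itin hm)) (hcontr xb hx yb hy)
  have hinv : 0 < θ⁻¹ := inv_pos.mpr hθ.1
  have hexp : (0 : ℝ) < 1 / N := one_div_pos.mpr (by exact_mod_cast hN)
  refine ⟨hagree, hcontr, ⟨θ⁻¹, 1 / N, hinv, hexp, hholder⟩, ?_⟩
  rintro φ ⟨C, α, hC, hα, hφ⟩
  refine ⟨C * θ⁻¹ ^ α, 1 / N * α, mul_pos hC (Real.rpow_pos_of_pos hinv α), mul_pos hexp hα, ?_⟩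
  intro xb hx yb hy
  have hd := dSeq_nonneg hθ.1.le xb yb
  calc |φ (itin hm xb) - φ (itin hm yb)|
      ≤ C * dSeq θ (itin hm xb) (itin hm yb) ^ α :=
        hφ _ (itin_mem_SFT hδ hg hx) _ (itin_mem_SFT hδ hg hy)
    _ ≤ C * (θ⁻¹ * dSeq θ xb yb ^ (1 / N : ℝ)) ^ α := by
        gcongr
        · exact dSeq_nonneg hθ.1.le _ _
        · exact hholder xb hx yb hy
    _ = C * θ⁻¹ ^ α * dSeq θ xb yb ^ (1 / N * α : ℝ) := by
        rw [Real.mul_rpow hinv.le (Real.rpow_nonneg hd _), ← Real.rpow_mul hd, mul_assoc]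

end
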